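/- arXiv:2506.20999 — 2 statements merged into one kernel-verified Lean document; each statement's English description precedes it below -/
import Mathlib

section
/- Let P ⊆ ℤ² be a finite set with at least two elements (so that conv(P) is an integral segment or an integral polygon). Then there exist a point t ∈ ℤ² and two finite multisets A and B, each of whose elements is the x-unit segment I_x, the y-unit segment I_y, or a unit triangle, such that conv(P) + Σ_{C ∈ B} C = {t} + Σ_{C ∈ A} C, where Σ denotes the Minkowski sum of the members of the multiset. (Equivalently, conv(P) = t + k_x I_x + k_y I_y + Σ_{T ∈ S} k_T T as a signed Minkowski decomposition with integer coefficients k_x, k_y, k_T and S a finite set of unit triangles.) -/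
open Pointwise

/-- The embedding of `ℤ²` into `ℝ²`. -/
noncomputable def toR (p : ℤ × ℤ) : ℝ × ℝ := ((p.1 : ℝ), (p.2 : ℝ))

/-- The `x`-unit segment `conv{(0,0),(1,0)}`. -/
noncomputable def Ix : Set (ℝ × ℝ) := segment ℝ (0, 0) (1, 0)

/-- The `y`-unit segment `conv{(0,0),(0,1)}`. -/
noncomputable def Iy : Set (ℝ × ℝ) := segment ℝ (0, 0) (0, 1)

/-- A unit triangle: a minimum integral triangle (area 1/2, i.e. `|det| = 1`) with all
vertex coordinates nonnegative, at least one vertex on the `y`-axis and at least one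
vertex on the `x`-axis. -/
def IsUnitTriangle (T : Set (ℝ × ℝ)) : Prop :=
  ∃ p₁ p₂ p₃ : ℤ × ℤ,
    T = convexHull ℝ ({toR p₁, toR p₂, toR p₃} : Set (ℝ × ℝ)) ∧
    |(p₂.1 - p₁.1) * (p₃.2 - p₁.2) - (p₂.2 - p₁.2) * (p₃.1 - p₁.1)| = 1 ∧
    0 ≤ p₁.1 ∧ 0 ≤ p₁.2 ∧ 0 ≤ p₂.1 ∧ 0 ≤ p₂.2 ∧ 0 ≤ p₃.1 ∧ 0 ≤ p₃.2 ∧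
    (p₁.1 = 0 ∨ p₂.1 = 0 ∨ p₃.1 = 0) ∧ (p₁.2 = 0 ∨ p₂.2 = 0 ∨ p₃.2 = 0)

/-- The pairing of `ℝ²` with itself by the standard scalar product. -/
def dot (z p : ℝ × ℝ) : ℝ := p.1 * z.1 + p.2 * z.2

theorem isLinearMap_dot (z : ℝ × ℝ) : IsLinearMap ℝ (dot z) where
  map_add p q := by simp only [dot, Prod.fst_add, Prod.snd_add]; ring
  map_smul c p := by simp only [dot, Prod.smul_fst, Prod.smul_snd, smul_eq_mul]; ring

theorem dot_add (z p q : ℝ × ℝ) : dot z (p + q) = dot z p + dot z q :=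
  (isLinearMap_dot z).map_add p q

/-- `C` is a compact convex set with support function `f`. -/
structure HasSupport (C : Set (ℝ × ℝ)) (f : ℝ × ℝ → ℝ) : Prop where
  convex : Convex ℝ C
  isCompact : IsCompact C
  isGreatest : ∀ z, IsGreatest (dot z '' C) (f z)

theorem HasSupport.add {C D : Set (ℝ × ℝ)} {f g : ℝ × ℝ → ℝ} (hC : HasSupport C f)
    (hD : HasSupport D g) : HasSupport (C + D) (f + g) where
  convex := hC.convex.add hD.convex
  isCompact := hC.isCompact.add hD.isCompact
  isGreatest z := by
    obtain ⟨⟨p, hp, hpf⟩, hf⟩ := hC.isGreatest z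
    obtain ⟨⟨q, hq, hqg⟩, hg⟩ := hD.isGreatest z
    refine ⟨⟨p + q, Set.add_mem_add hp hq, by rw [dot_add, hpf, hqg]; rfl⟩, ?_⟩
    rintro _ ⟨_, ⟨a, ha, b, hb, rfl⟩, rfl⟩
    simp only [dot_add]
    exact add_le_add (hf ⟨a, ha, rfl⟩) (hg ⟨b, hb, rfl⟩)

theorem HasSupport.subset {C D : Set (ℝ × ℝ)} {f : ℝ × ℝ → ℝ} (hC : HasSupport C f)
    (hD : HasSupport D f) : C ⊆ D := by
  intro x hx
  by_contra hxD
  obtain ⟨φ, u, h₁, h₂⟩ :=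
    geometric_hahn_banach_closed_point hD.convex hD.isCompact.isClosed hxD
  have hφ (p : ℝ × ℝ) : φ p = dot (φ (1, 0), φ (0, 1)) p := by
    have : p = p.1 • ((1, 0) : ℝ × ℝ) + p.2 • ((0, 1) : ℝ × ℝ) := by ext <;> simp
    conv_lhs => rw [this]
    rw [map_add, map_smul, map_smul]
    rfl
  obtain ⟨q, hq, hqf⟩ := (hD.isGreatest (φ (1, 0), φ (0, 1))).1
  have hle := (hC.isGreatest (φ (1, 0), φ (0, 1))).2 ⟨x, hx, rfl⟩
  have := h₁ q hq
  rw [hφ] at this h₂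
  linarith

theorem HasSupport.eq {C D : Set (ℝ × ℝ)} {f : ℝ × ℝ → ℝ} (hC : HasSupport C f)
    (hD : HasSupport D f) : C = D :=
  (hC.subset hD).antisymm (hD.subset hC)

theorem hasSupport_convexHull {S : Set (ℝ × ℝ)} {f : ℝ × ℝ → ℝ} (hS : S.Finite)
    (h : ∀ z, IsGreatest (dot z '' S) (f z)) : HasSupport (convexHull ℝ S) f where
  convex := convex_convexHull ℝ S
  isCompact := hS.isCompact_convexHull ℝ
  isGreatest z := by
    refine ⟨Set.image_mono (subset_convexHull ℝ S) (h z).1, ?_⟩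
    rintro _ ⟨p, hp, rfl⟩
    exact convexHull_min (fun q hq ↦ (h z).2 ⟨q, hq, rfl⟩)
      (convex_halfSpace_le (isLinearMap_dot z) (f z)) hp

/-- The linear function on `ℝ²` given by a lattice point. -/
noncomputable def lin (p : ℤ × ℤ) : ℝ × ℝ → ℝ := fun z ↦ dot z (toR p)

theorem lin_apply (p : ℤ × ℤ) (z : ℝ × ℝ) : lin p z = p.1 * z.1 + p.2 * z.2 := rfl

theorem lin_add (p q : ℤ × ℤ) : lin (p + q) = lin p + lin q := by
  funext z; simp only [lin_apply, Pi.add_apply, Prod.fst_add, Prod.snd_add, Int.cast_add]; ring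

theorem lin_sub (p q : ℤ × ℤ) : lin (p - q) = lin p - lin q := by
  funext z; simp only [lin_apply, Pi.sub_apply, Prod.fst_sub, Prod.snd_sub, Int.cast_sub]; ring

theorem lin_neg (p : ℤ × ℤ) : lin (-p) = -lin p := by
  funext z; simp only [lin_apply, Pi.neg_apply, Prod.fst_neg, Prod.snd_neg, Int.cast_neg]; ring

theorem lin_zsmul (n : ℤ) (p : ℤ × ℤ) (z : ℝ × ℝ) : lin (n • p) z = n * lin p z := by
  simp only [lin_apply, Prod.smul_fst, Prod.smul_snd, smul_eq_mul, Int.cast_mul]; ring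

theorem zsmul_fun_apply (n : ℤ) (f : ℝ × ℝ → ℝ) (z : ℝ × ℝ) : (n • f) z = n * f z := by
  rw [Pi.smul_apply, zsmul_eq_mul]

theorem hasSupport_singleton (t : ℤ × ℤ) : HasSupport {toR t} (lin t) where
  convex := convex_singleton _
  isCompact := isCompact_singleton
  isGreatest z := by
    rw [Set.image_singleton]
    exact isGreatest_singleton

/-- The support function of the segment `conv{0, u}`. -/
noncomputable def segSupport (u : ℤ × ℤ) : ℝ × ℝ → ℝ := fun z ↦ max 0 (lin u z)

/-- The support function of the triangle `conv{0, u, w}`. -/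
noncomputable def triSupport (u w : ℤ × ℤ) : ℝ × ℝ → ℝ :=
  fun z ↦ max 0 (max (lin u z) (lin w z))

theorem isGreatest_pair_max (a b : ℝ) : IsGreatest {a, b} (max a b) := by
  simpa using isGreatest_pair (a := a) (b := b)

theorem isGreatest_triple_max (a b c : ℝ) : IsGreatest {a, b, c} (max a (max b c)) :=
  (isGreatest_pair_max b c).insert a

theorem hasSupport_segment (u : ℤ × ℤ) :
    HasSupport (segment ℝ (0, 0) (toR u)) (segSupport u) := by
  rw [← convexHull_pair]
  refine hasSupport_convexHull (Set.toFinite _) fun z ↦ ?_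
  rw [Set.image_pair, show dot z (0, 0) = 0 by simp [dot]]
  exact isGreatest_pair_max _ _

theorem hasSupport_triangle (t u w : ℤ × ℤ) :
    HasSupport (convexHull ℝ {toR t, toR (t + u), toR (t + w)}) (lin t + triSupport u w) := by
  refine hasSupport_convexHull (Set.toFinite _) fun z ↦ ?_
  rw [Set.image_insert_eq, Set.image_pair]
  have h : (lin t + triSupport u w) z = max (lin t z) (max (lin (t + u) z) (lin (t + w) z)) := by
    simp only [lin_add, triSupport, Pi.add_apply]
    rw [← max_add_add_left, ← max_add_add_left, add_zero]
  rw [h]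
  exact isGreatest_triple_max _ _ _

/-- The unit segments and unit triangles. -/
def IsPiece (C : Set (ℝ × ℝ)) : Prop := C = Ix ∨ C = Iy ∨ IsUnitTriangle C

/-- The group generated by the support functions of lattice points, unit segments and unit
triangles. -/
def supportGroup : AddSubgroup (ℝ × ℝ → ℝ) :=
  AddSubgroup.closure (Set.range lin ∪ {f | ∃ C, IsPiece C ∧ HasSupport C f})

theorem lin_mem (p : ℤ × ℤ) : lin p ∈ supportGroup :=
  AddSubgroup.subset_closure (Or.inl ⟨p, rfl⟩)

theorem mem_of_isPiece {C : Set (ℝ × ℝ)} {f : ℝ × ℝ → ℝ} (hC : IsPiece C)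
    (h : HasSupport C f) : f ∈ supportGroup :=
  AddSubgroup.subset_closure (Or.inr ⟨C, hC, h⟩)

theorem exists_decomposition {f : ℝ × ℝ → ℝ} (hf : f ∈ supportGroup) :
    ∃ (t : ℤ × ℤ) (A B : Multiset (Set (ℝ × ℝ))) (a b : ℝ × ℝ → ℝ),
      (∀ C ∈ A, IsPiece C) ∧ (∀ C ∈ B, IsPiece C) ∧
      HasSupport A.sum a ∧ HasSupport B.sum b ∧ f + b = lin t + a := by
  have h0 : HasSupport 0 0 := by
    convert hasSupport_singleton 0
    · simp [toR, ← Set.singleton_zero, Prod.ext_iff]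
    · funext z; simp [lin_apply]
  have l0 : lin 0 = 0 := by funext z; simp [lin_apply]
  induction hf using AddSubgroup.closure_induction with
  | mem f hf =>
    rcases hf with ⟨t, rfl⟩ | ⟨C, hC, h⟩
    · exact ⟨t, 0, 0, 0, 0, by simp, by simp, by simpa using h0, by simpa using h0, rfl⟩
    · exact ⟨0, {C}, 0, f, 0, by simpa using hC, by simp, by simpa using h, by simpa using h0,
        by rw [l0, add_comm]⟩
  | zero =>
    exact ⟨0, 0, 0, 0, 0, by simp, by simp, by simpa using h0, by simpa using h0, by simp [l0]⟩
  | add f g _ _ hf hg =>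
    obtain ⟨t, A, B, a, b, hA, hB, ha, hb, h⟩ := hf
    obtain ⟨t', A', B', a', b', hA', hB', ha', hb', h'⟩ := hg
    refine ⟨t + t', A + A', B + B', a + a', b + b', ?_, ?_, ?_, ?_, ?_⟩
    · intro C hC; exact (Multiset.mem_add.1 hC).elim (hA C) (hA' C)
    · intro C hC; exact (Multiset.mem_add.1 hC).elim (hB C) (hB' C)
    · rw [Multiset.sum_add]; exact ha.add ha'
    · rw [Multiset.sum_add]; exact hb.add hb'
    · rw [lin_add, add_add_add_comm, h, h', add_add_add_comm]
  | neg f _ hf =>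
    obtain ⟨t, A, B, a, b, hA, hB, ha, hb, h⟩ := hf
    refine ⟨-t, B, A, b, a, hB, hA, hb, ha, ?_⟩
    rw [lin_neg, eq_sub_of_add_eq h]
    abel

theorem segSupport_fst_mem : segSupport (1, 0) ∈ supportGroup := by
  refine mem_of_isPiece (Or.inl ?_) (hasSupport_segment _)
  simp [Ix, toR]

theorem segSupport_snd_mem : segSupport (0, 1) ∈ supportGroup := by
  refine mem_of_isPiece (Or.inr (Or.inl ?_)) (hasSupport_segment _)
  simp [Iy, toR]

theorem segSupport_neg_mem {u : ℤ × ℤ} (h : segSupport u ∈ supportGroup) :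
    segSupport (-u) ∈ supportGroup := by
  have : segSupport (-u) = segSupport u - lin u := by
    funext z
    simp only [segSupport, lin_neg, Pi.neg_apply, Pi.sub_apply]
    rw [← max_sub_sub_right, zero_sub, sub_self, max_comm]
  rw [this]
  exact sub_mem h (lin_mem u)

theorem segSupport_zsmul {n : ℤ} (hn : 0 ≤ n) (u : ℤ × ℤ) :
    segSupport (n • u) = n • segSupport u := by
  funext z
  simp only [segSupport, lin_zsmul, zsmul_fun_apply]
  rw [mul_max_of_nonneg _ _ (by exact_mod_cast hn), mul_zero]

theorem triSupport_comm (u w : ℤ × ℤ) : triSupport u w = triSupport w u := by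
  funext z; simp only [triSupport, max_comm (lin u z)]

theorem triSupport_mem_of_abs_det {u w : ℤ × ℤ} (h : |u.1 * w.2 - u.2 * w.1| = 1) :
    triSupport u w ∈ supportGroup := by
  obtain ⟨u₁, u₂⟩ := u
  obtain ⟨w₁, w₂⟩ := w
  let t : ℤ × ℤ := (-min 0 (min u₁ w₁), -min 0 (min u₂ w₂))
  have ht : IsUnitTriangle
      (convexHull ℝ {toR t, toR (t + (u₁, u₂)), toR (t + (w₁, w₂))}) := by
    refine ⟨t, _, _, rfl, ?_, ?_⟩
    · simpa using h
    · simp only [t, Prod.mk_add_mk]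
      omega
  have := sub_mem (mem_of_isPiece (Or.inr (Or.inr ht)) (hasSupport_triangle t _ _)) (lin_mem t)
  rwa [add_sub_cancel_left] at this

/-- Cutting a unimodular parallelogram along a diagonal. -/
theorem segSupport_add_mem {u w : ℤ × ℤ} (h : |u.1 * w.2 - u.2 * w.1| = 1)
    (hu : segSupport u ∈ supportGroup) (hw : segSupport w ∈ supportGroup) :
    segSupport (u + w) ∈ supportGroup := by
  have key : segSupport (u + w) =
      triSupport u (u + w) + triSupport w (u + w) - segSupport u - segSupport w := by
    funext z
    simp only [segSupport, triSupport, lin_add, Pi.add_apply, Pi.sub_apply]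
    grind
  rw [key]
  refine sub_mem (sub_mem (add_mem (triSupport_mem_of_abs_det ?_)
    (triSupport_mem_of_abs_det ?_)) hu) hw
  · rw [← h]; congr 1; simp only [Prod.fst_add, Prod.snd_add]; ring
  · rw [← h, ← abs_neg]; congr 1; simp only [Prod.fst_add, Prod.snd_add]; ring

theorem segSupport_combination_mem (a b : ℕ) {u w : ℤ × ℤ}
    (h : |u.1 * w.2 - u.2 * w.1| = 1)
    (hu : segSupport u ∈ supportGroup) (hw : segSupport w ∈ supportGroup) :
    segSupport ((a : ℤ) • u + (b : ℤ) • w) ∈ supportGroup := by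
  induction hn : a + b using Nat.strong_induction_on generalizing a b u w with
  | _ n ih =>
    rcases Nat.eq_zero_or_pos a with rfl | ha
    · rw [Nat.cast_zero, zero_smul, zero_add, segSupport_zsmul (Int.natCast_nonneg b)]
      exact zsmul_mem hw _
    rcases Nat.eq_zero_or_pos b with rfl | hb
    · rw [Nat.cast_zero, zero_smul, add_zero, segSupport_zsmul (Int.natCast_nonneg a)]
      exact zsmul_mem hu _
    have huw := segSupport_add_mem h hu hw
    rcases le_total b a with hab | hab
    · have := ih (a - b + b) (by omega) (a - b) b (u := u) (w := u + w)
        (by rw [← h]; congr 1; simp only [Prod.fst_add, Prod.snd_add]; ring) hu huw rfl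
      convert this using 2
      push_cast [hab]
      module
    · have := ih (a + (b - a)) (by omega) a (b - a) (u := u + w) (w := w)
        (by rw [← h]; congr 1; simp only [Prod.fst_add, Prod.snd_add]; ring) huw hw rfl
      convert this using 2
      push_cast [hab]
      module

theorem segSupport_mem (u : ℤ × ℤ) : segSupport u ∈ supportGroup := by
  obtain ⟨a, b⟩ := u
  obtain ⟨m, rfl | rfl⟩ := a.eq_nat_or_neg <;> obtain ⟨n, rfl | rfl⟩ := b.eq_nat_or_neg
  · simpa using segSupport_combination_mem m n (by simp) segSupport_fst_mem segSupport_snd_mem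
  · simpa using segSupport_combination_mem m n (by simp) segSupport_fst_mem
      (segSupport_neg_mem segSupport_snd_mem)
  · simpa using segSupport_combination_mem m n (by simp)
      (segSupport_neg_mem segSupport_fst_mem) segSupport_snd_mem
  · simpa using segSupport_combination_mem m n (by simp)
      (segSupport_neg_mem segSupport_fst_mem) (segSupport_neg_mem segSupport_snd_mem)

theorem exists_eq_smul_primitive (u : ℤ × ℤ) :
    ∃ (d : ℤ) (g : ℤ × ℤ) (p r : ℤ), 0 ≤ d ∧ u = d • g ∧ p * g.1 + r * g.2 = 1 := by
  obtain ⟨u₁, u₂⟩ := u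
  by_cases h : u₁ = 0 ∧ u₂ = 0
  · exact ⟨0, (1, 0), 1, 0, le_rfl, by simp [h.1, h.2], by simp⟩
  · have hpos : 0 < Int.gcd u₁ u₂ := Int.gcd_pos_iff.2 (by tauto)
    obtain ⟨g₁, g₂, hg, h₁, h₂⟩ := Int.exists_gcd_one hpos
    obtain ⟨p, r, hpr⟩ := Int.isCoprime_iff_gcd_eq_one.2 hg
    refine ⟨Int.gcd u₁ u₂, (g₁, g₂), p, r, by positivity, ?_, hpr⟩
    ext
    · simpa [mul_comm] using h₁
    · simpa [mul_comm] using h₂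

theorem triSupport_mem_of_det_eq_zero {u w : ℤ × ℤ} (h : u.1 * w.2 - u.2 * w.1 = 0) :
    triSupport u w ∈ supportGroup := by
  obtain ⟨d, g, p, r, hd, rfl, hg⟩ := exists_eq_smul_primitive u
  rcases hd.eq_or_lt with rfl | hd
  · convert segSupport_mem w using 1
    funext z
    simp only [triSupport, segSupport, lin_zsmul, Int.cast_zero, zero_mul]
    rw [← max_assoc, max_self]
  have hdet : g.1 * w.2 = g.2 * w.1 := by
    simp only [Prod.smul_fst, Prod.smul_snd, smul_eq_mul] at h
    exact mul_left_cancel₀ hd.ne' (by linear_combination h)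
  obtain ⟨b, rfl⟩ : ∃ b : ℤ, w = b • g := by
    refine ⟨p * w.1 + r * w.2, ?_⟩
    ext
    · simp only [Prod.smul_fst, smul_eq_mul]
      linear_combination (-w.1) * hg - r * hdet
    · simp only [Prod.smul_snd, smul_eq_mul]
      linear_combination (-w.2) * hg + p * hdet
  have key : triSupport (d • g) (b • g) =
      (max d b) • segSupport g + (min 0 b) • (lin g - segSupport g) := by
    funext z
    have hd' : (0 : ℝ) < d := by exact_mod_cast hd
    simp only [triSupport, segSupport, lin_zsmul, Pi.add_apply, Pi.sub_apply,
      zsmul_fun_apply, Int.cast_max, Int.cast_min, Int.cast_zero]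
    generalize lin g z = c
    generalize (d : ℝ) = d at *
    generalize (b : ℝ) = b at *
    rcases le_total 0 c with hc | hc
    · rw [max_eq_right hc, ← max_mul_of_nonneg _ _ hc, sub_self, mul_zero, add_zero]
      exact max_eq_right (mul_nonneg (hd'.le.trans (le_max_left _ _)) hc)
    · have hdc : d * c ≤ 0 := mul_nonpos_of_nonneg_of_nonpos hd'.le hc
      rw [max_eq_left hc, mul_zero, zero_add, sub_zero, ← max_assoc, max_eq_left hdc]
      rcases le_total 0 b with hb | hb
      · rw [min_eq_left hb, zero_mul, max_eq_left (mul_nonpos_of_nonneg_of_nonpos hb hc)]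
      · rw [min_eq_right hb, max_eq_right (mul_nonneg_of_nonpos_of_nonpos hb hc)]
  rw [key]
  exact add_mem (zsmul_mem (segSupport_mem g) _)
    (zsmul_mem (sub_mem (lin_mem g) (segSupport_mem g)) _)

/-- A lattice triangle of normalized area at least two contains a lattice point which is not one of
its vertices. -/
theorem exists_lattice_point {n : ℤ} (hn : 2 ≤ n) {u w : ℤ × ℤ}
    (h : u.1 * w.2 - u.2 * w.1 = n) :
    ∃ (x : ℤ × ℤ) (i j : ℤ), 0 ≤ i ∧ 0 ≤ j ∧ i < n ∧ j < n ∧ 0 < i + j ∧ i + j ≤ n ∧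
      n • x = i • u + j • w := by
  obtain ⟨d, g, p, r, hd, rfl, hg⟩ := exists_eq_smul_primitive u
  simp only [Prod.smul_fst, Prod.smul_snd, smul_eq_mul] at h
  have hk : n = d * (g.1 * w.2 - g.2 * w.1) := by linear_combination -h
  rcases (show d = 0 ∨ d = 1 ∨ 2 ≤ d by omega) with rfl | rfl | hd
  · omega
  · have hm := Int.emod_nonneg (-(p * w.1 + r * w.2)) (show n ≠ 0 by omega)
    have hm' := Int.emod_lt_of_pos (-(p * w.1 + r * w.2)) (show 0 < n by omega)
    have hm'' := Int.emod_add_mul_ediv (-(p * w.1 + r * w.2)) n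
    set m := -(p * w.1 + r * w.2) % n
    set q := -(p * w.1 + r * w.2) / n
    refine ⟨(-r - q * g.1, p - q * g.2), m, 1, hm, by omega, hm', by omega, by omega,
      by omega, ?_⟩
    ext
    · simp only [Prod.smul_fst, Prod.fst_add, smul_eq_mul]
      linear_combination -g.1 * hm'' - r * hk + w.1 * hg
    · simp only [Prod.smul_snd, Prod.snd_add, smul_eq_mul]
      linear_combination -g.2 * hm'' + p * hk + w.2 * hg
  · have hpos : 0 < g.1 * w.2 - g.2 * w.1 := by
      by_contra hneg
      nlinarith
    refine ⟨g, g.1 * w.2 - g.2 * w.1, 0, hpos.le, le_rfl, by nlinarith, by omega, by omega,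
      by nlinarith, ?_⟩
    rw [zero_smul, add_zero, smul_smul, mul_comm, ← hk]

theorem max_subdivide {a b c q : ℝ} (hmin : min c (min a b) ≤ q) (hmax : q ≤ max c (max a b)) :
    max c (max a b) + max c q + max q a + max q b =
      max c (max a q) + max c (max q b) + max q (max a b) + q := by
  rcases le_total c a with h₁ | h₁ <;> rcases le_total c b with h₂ | h₂ <;>
    rcases le_total a b with h₃ | h₃ <;> rcases le_total c q with h₄ | h₄ <;>
    rcases le_total a q with h₅ | h₅ <;> rcases le_total b q with h₆ | h₆ <;>
    simp only [max_eq_left, max_eq_right, min_eq_left, min_eq_right, h₁, h₂, h₃, h₄, h₅, h₆]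
      at hmin hmax ⊢ <;> linarith

/-- Subdividing a triangle at one of its points. -/
theorem triSupport_subdivide {n i j : ℤ} {u w x : ℤ × ℤ} (hn : 0 < n) (hi : 0 ≤ i) (hj : 0 ≤ j)
    (hij : i + j ≤ n) (hx : n • x = i • u + j • w) :
    triSupport u w = triSupport u x + triSupport x w + triSupport (u - x) (w - x)
      - segSupport x - segSupport (u - x) - segSupport (w - x) := by
  funext z
  have hq : (n : ℝ) * lin x z = i * lin u z + j * lin w z := by
    rw [← lin_zsmul, hx, lin_add, Pi.add_apply, lin_zsmul, lin_zsmul]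
  have hn' : (0 : ℝ) < n := by exact_mod_cast hn
  have hi' : (0 : ℝ) ≤ i := by exact_mod_cast hi
  have hj' : (0 : ℝ) ≤ j := by exact_mod_cast hj
  have hij' : (i : ℝ) + j ≤ n := by exact_mod_cast hij
  simp only [triSupport, segSupport, lin_sub, Pi.add_apply, Pi.sub_apply]
  generalize lin x z = q at *
  generalize lin u z = a at *
  generalize lin w z = b at *
  have hmax : q ≤ max 0 (max a b) := by
    have h0 : 0 ≤ max 0 (max a b) := le_max_left _ _
    have ha : a ≤ max 0 (max a b) := by simp
    have hb : b ≤ max 0 (max a b) := by simp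
    refine le_of_mul_le_mul_left ?_ hn'
    nlinarith [mul_le_mul_of_nonneg_left ha hi', mul_le_mul_of_nonneg_left hb hj',
      mul_le_mul_of_nonneg_right hij' h0]
  have hmin : min 0 (min a b) ≤ q := by
    have h0 : min 0 (min a b) ≤ 0 := min_le_left _ _
    have ha : min 0 (min a b) ≤ a := by simp
    have hb : min 0 (min a b) ≤ b := by simp
    refine le_of_mul_le_mul_left ?_ hn'
    nlinarith [mul_le_mul_of_nonneg_left ha hi', mul_le_mul_of_nonneg_left hb hj',
      mul_le_mul_of_nonpos_right hij' h0]
  have key := max_subdivide hmin hmax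
  rw [← sub_self q, max_sub_sub_right, max_sub_sub_right, max_sub_sub_right, max_sub_sub_right,
    sub_self]
  linarith

theorem triSupport_mem_of_det_nonneg (n : ℕ) {u w : ℤ × ℤ}
    (h : u.1 * w.2 - u.2 * w.1 = n) : triSupport u w ∈ supportGroup := by
  induction n using Nat.strong_induction_on generalizing u w with
  | _ n ih =>
    rcases (show n = 0 ∨ n = 1 ∨ 2 ≤ n by omega) with rfl | rfl | hn
    · exact triSupport_mem_of_det_eq_zero (by simpa using h)
    · exact triSupport_mem_of_abs_det (by simp [h])
    obtain ⟨x, i, j, hi, hj, hin, hjn, hpos, hij, hx⟩ :=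
      exists_lattice_point (by exact_mod_cast hn) h
    have hn0 : (n : ℤ) ≠ 0 := by omega
    have hx₁ := congrArg Prod.fst hx
    have hx₂ := congrArg Prod.snd hx
    simp only [Prod.smul_fst, Prod.smul_snd, Prod.fst_add, Prod.snd_add, smul_eq_mul] at hx₁ hx₂
    have hux : u.1 * x.2 - u.2 * x.1 = j := mul_left_cancel₀ hn0 (by
      linear_combination u.1 * hx₂ - u.2 * hx₁ + j * h)
    have hxw : x.1 * w.2 - x.2 * w.1 = i := mul_left_cancel₀ hn0 (by
      linear_combination w.2 * hx₁ - w.1 * hx₂ + i * h)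
    rw [triSupport_subdivide (by omega) hi hj hij hx]
    refine sub_mem (sub_mem (sub_mem (add_mem (add_mem ?_ ?_) ?_) (segSupport_mem _))
      (segSupport_mem _)) (segSupport_mem _)
    · exact ih j.toNat (by omega) (by omega)
    · exact ih i.toNat (by omega) (by omega)
    · refine ih (n - i - j).toNat (by omega) ?_
      rw [Int.toNat_of_nonneg (by omega), Prod.fst_sub, Prod.snd_sub, Prod.fst_sub, Prod.snd_sub]
      linear_combination h - hux - hxw

theorem triSupport_mem (u w : ℤ × ℤ) : triSupport u w ∈ supportGroup := by
  rcases le_total 0 (u.1 * w.2 - u.2 * w.1) with h | h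
  · exact triSupport_mem_of_det_nonneg _ (Int.toNat_of_nonneg h).symm
  · rw [triSupport_comm]
    refine triSupport_mem_of_det_nonneg (w.1 * u.2 - w.2 * u.1).toNat ?_
    rw [Int.toNat_of_nonneg (by linarith)]

/-- The support function of the convex hull of a finite set of lattice points. -/
noncomputable def hullSupport (P : Finset (ℤ × ℤ)) : ℝ × ℝ → ℝ :=
  fun z ↦ sSup ((fun p ↦ lin p z) '' (P : Set (ℤ × ℤ)))

theorem isGreatest_hullSupport {P : Finset (ℤ × ℤ)} (hP : P.Nonempty) (z : ℝ × ℝ) :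
    IsGreatest ((fun p ↦ lin p z) '' (P : Set (ℤ × ℤ))) (hullSupport P z) :=
  have hfin := P.finite_toSet.image (fun p ↦ lin p z)
  ⟨Set.Nonempty.csSup_mem (hP.to_set.image _) hfin, fun _ h ↦ le_csSup hfin.bddAbove h⟩

theorem hasSupport_hullSupport {P : Finset (ℤ × ℤ)} (hP : P.Nonempty) :
    HasSupport (convexHull ℝ (toR '' (P : Set (ℤ × ℤ)))) (hullSupport P) := by
  refine hasSupport_convexHull (P.finite_toSet.image _) fun z ↦ ?_
  rw [Set.image_image]
  exact isGreatest_hullSupport hP z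

theorem hullSupport_erase {P : Finset (ℤ × ℤ)} {a b : ℤ × ℤ} {z : ℝ × ℝ} (hb : b ∈ P)
    (hab : a ≠ b) (h : lin a z ≤ lin b z) : hullSupport (P.erase a) z = hullSupport P z := by
  have hb' : b ∈ P.erase a := Finset.mem_erase.2 ⟨hab.symm, hb⟩
  refine (isGreatest_hullSupport ⟨b, hb'⟩ z).unique ⟨?_, ?_⟩
  · obtain ⟨p, hp, hpz⟩ := (isGreatest_hullSupport ⟨b, hb⟩ z).1
    by_cases hpa : p = a
    · subst hpa
      exact ⟨b, hb', le_antisymm ((isGreatest_hullSupport ⟨b, hb⟩ z).2 ⟨b, hb, rfl⟩)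
        (hpz ▸ h)⟩
    · exact ⟨p, Finset.mem_erase.2 ⟨hpa, hp⟩, hpz⟩
  · rintro _ ⟨p, hp, rfl⟩
    exact (isGreatest_hullSupport ⟨b, hb⟩ z).2 ⟨p, Finset.mem_of_mem_erase hp, rfl⟩

/-- Inclusion-exclusion for the subsets of `P` obtained by deleting points of `I`, when in every
direction some point of `I` lies below some point of `P \ I`. -/
theorem sum_powerset_hullSupport {P I : Finset (ℤ × ℤ)}
    (h : ∀ z, ∃ a ∈ I, ∃ b ∈ P \ I, lin a z ≤ lin b z) :
    ∑ S ∈ I.powerset, (-1 : ℤ) ^ S.card • hullSupport (P \ S) = 0 := by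
  funext z
  obtain ⟨a, ha, b, hb, hab⟩ := h z
  obtain ⟨hbP, hbI⟩ := Finset.mem_sdiff.1 hb
  rw [← Finset.insert_erase ha, Finset.sum_powerset_insert (Finset.notMem_erase a I),
    ← Finset.sum_add_distrib, Finset.sum_apply]
  refine Finset.sum_eq_zero fun S hS ↦ ?_
  have hSI := Finset.mem_powerset.1 hS
  have haS : a ∉ S := fun h ↦ Finset.notMem_erase a I (hSI h)
  have hbS : b ∈ P \ S :=
    Finset.mem_sdiff.2 ⟨hbP, fun h ↦ hbI (Finset.mem_of_mem_erase (hSI h))⟩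
  have hne : a ≠ b := fun h ↦ hbI (h ▸ ha)
  have hins : P \ insert a S = (P \ S).erase a := by
    ext p
    simp only [Finset.mem_sdiff, Finset.mem_insert, Finset.mem_erase]
    tauto
  simp only [Pi.add_apply, Pi.smul_apply]
  rw [hins, hullSupport_erase hbS hne hab, Finset.card_insert_of_notMem haS, pow_succ]
  simp

theorem hullSupport_mem_of_relation {P : Finset (ℤ × ℤ)} {c : ℤ × ℤ → ℝ}
    (hc : ∑ p ∈ P, c p = 0) (hcp : ∑ p ∈ P, c p • toR p = 0) (hne : ∃ p ∈ P, c p ≠ 0)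
    (ih : ∀ Q ⊂ P, Q.Nonempty → hullSupport Q ∈ supportGroup) :
    hullSupport P ∈ supportGroup := by
  classical
  let I := P.filter fun p ↦ 0 < c p
  obtain ⟨i, hiP, hi⟩ := Finset.exists_pos_of_sum_zero_of_exists_nonzero c hc hne
  have hiI : i ∈ I := Finset.mem_filter.2 ⟨hiP, hi⟩
  have hJ : (P \ I).Nonempty := by
    by_contra hJ
    rw [Finset.not_nonempty_iff_eq_empty, Finset.sdiff_eq_empty_iff_subset] at hJ
    exact (Finset.sum_pos (fun p hp ↦ (Finset.mem_filter.1 (hJ hp)).2) ⟨i, hiP⟩).ne' hc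
  have hmin : ∀ z, ∃ a ∈ I, ∃ b ∈ P \ I, lin a z ≤ lin b z := by
    intro z
    by_contra! hlt
    have hz : ∑ p ∈ P, c p * lin p z = 0 := by
      have h₁ := congrArg Prod.fst hcp
      have h₂ := congrArg Prod.snd hcp
      simp only [Prod.fst_sum, Prod.snd_sum, Prod.smul_fst, Prod.smul_snd, smul_eq_mul, toR,
        Prod.fst_zero, Prod.snd_zero] at h₁ h₂
      calc ∑ p ∈ P, c p * lin p z
          = (∑ p ∈ P, c p * (p.1 : ℝ)) * z.1 + (∑ p ∈ P, c p * (p.2 : ℝ)) * z.2 := by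
            rw [Finset.sum_mul, Finset.sum_mul, ← Finset.sum_add_distrib]
            exact Finset.sum_congr rfl fun p _ ↦ by rw [lin_apply]; ring
        _ = 0 := by rw [h₁, h₂]; ring
    obtain ⟨b, hb, hbmax⟩ := (P \ I).exists_max_image (fun p ↦ lin p z) hJ
    have hpos : 0 < ∑ p ∈ P, c p * (lin p z - lin b z) := by
      refine Finset.sum_pos' (fun p hp ↦ ?_) ⟨i, hiP, mul_pos hi (sub_pos.2 (hlt i hiI b hb))⟩
      by_cases hpI : p ∈ I
      · exact (mul_pos (Finset.mem_filter.1 hpI).2 (sub_pos.2 (hlt p hpI b hb))).le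
      · refine mul_nonneg_of_nonpos_of_nonpos ?_
          (sub_nonpos.2 (hbmax p (Finset.mem_sdiff.2 ⟨hp, hpI⟩)))
        by_contra! hcp
        exact hpI (Finset.mem_filter.2 ⟨hp, hcp⟩)
    simp only [mul_sub, Finset.sum_sub_distrib, ← Finset.sum_mul, hz, hc] at hpos
    simp at hpos
  have hsum := sum_powerset_hullSupport hmin
  rw [← Finset.add_sum_erase _ _ (Finset.empty_mem_powerset I)] at hsum
  simp only [Finset.card_empty, pow_zero, one_smul, Finset.sdiff_empty] at hsum
  rw [eq_neg_of_add_eq_zero_left hsum]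
  refine neg_mem (sum_mem fun S hS ↦ zsmul_mem (ih _ ?_ ?_) _)
  · obtain ⟨hS, hSI⟩ := Finset.mem_erase.1 hS
    exact Finset.sdiff_ssubset ((Finset.mem_powerset.1 hSI).trans (Finset.filter_subset _ _))
      (Finset.nonempty_iff_ne_empty.2 hS)
  · exact hJ.mono (Finset.sdiff_subset_sdiff le_rfl
      (Finset.mem_powerset.1 (Finset.mem_of_mem_erase hS)))

theorem toR_injective : Function.Injective toR := fun p q h ↦ by
  simpa [toR, Prod.ext_iff] using h

theorem exists_relation {P : Finset (ℤ × ℤ)} (hP : 4 ≤ P.card) :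
    ∃ c : ℤ × ℤ → ℝ, ∑ p ∈ P, c p = 0 ∧ ∑ p ∈ P, c p • toR p = 0 ∧ ∃ p ∈ P, c p ≠ 0 := by
  classical
  obtain ⟨f, h₁, h₂, h₃⟩ :=
    Module.exists_nontrivial_relation_sum_zero_of_finrank_succ_lt_card
      (R := ℝ) (t := P.image toR) (by
        rw [Finset.card_image_of_injective _ toR_injective]
        simp
        omega)
  rw [Finset.sum_image toR_injective.injOn] at h₁ h₂
  obtain ⟨_, hx, hfx⟩ := h₃
  obtain ⟨p, hp, rfl⟩ := Finset.mem_image.1 hx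
  exact ⟨f ∘ toR, h₂, h₁, p, hp, hfx⟩

theorem hullSupport_mem {P : Finset (ℤ × ℤ)} (hP : P.Nonempty) :
    hullSupport P ∈ supportGroup := by
  classical
  induction P using Finset.strongInduction with
  | _ P ih =>
    have hpos := hP.card_pos
    rcases (show P.card = 1 ∨ P.card = 2 ∨ P.card = 3 ∨ 4 ≤ P.card by omega) with h | h | h | h
    · obtain ⟨a, rfl⟩ := Finset.card_eq_one.1 h
      convert lin_mem a using 1
      funext z
      simp [hullSupport]
    · obtain ⟨a, b, -, rfl⟩ := Finset.card_eq_two.1 h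
      suffices hullSupport {a, b} = lin a + segSupport (b - a) from
        this ▸ add_mem (lin_mem a) (segSupport_mem _)
      funext z
      have hz : (lin a + segSupport (b - a)) z = max (lin a z) (lin b z) := by
        simp only [segSupport, lin_sub, Pi.add_apply, Pi.sub_apply]
        rw [← max_add_add_left, add_zero, add_sub_cancel]
      refine (isGreatest_hullSupport hP z).unique ?_
      rw [hz, Finset.coe_pair, Set.image_pair]
      exact isGreatest_pair_max _ _
    · obtain ⟨a, b, c, -, -, -, rfl⟩ := Finset.card_eq_three.1 h
      suffices hullSupport {a, b, c} = lin a + triSupport (b - a) (c - a) from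
        this ▸ add_mem (lin_mem a) (triSupport_mem _ _)
      funext z
      have hz : (lin a + triSupport (b - a) (c - a)) z =
          max (lin a z) (max (lin b z) (lin c z)) := by
        simp only [triSupport, lin_sub, Pi.add_apply, Pi.sub_apply]
        rw [← max_add_add_left, ← max_add_add_left, add_zero, add_sub_cancel, add_sub_cancel]
      refine (isGreatest_hullSupport hP z).unique ?_
      rw [hz, Finset.coe_insert, Finset.coe_pair, Set.image_insert_eq, Set.image_pair]
      exact isGreatest_triple_max _ _ _
    · obtain ⟨c, h₁, h₂, h₃⟩ := exists_relation h
      exact hullSupport_mem_of_relation h₁ h₂ h₃ ih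

/-- Every integral segment or polygon has a signed Minkowski decomposition
into a translation, unit segments, and unit triangles:
`conv(P) + Σ_{C ∈ B} C = {t} + Σ_{C ∈ A} C`. -/
theorem integral_polygon_signed_decomposition (P : Finset (ℤ × ℤ)) (hP : 2 ≤ P.card) :
    ∃ (t : ℤ × ℤ) (A B : Multiset (Set (ℝ × ℝ))),
      (∀ C ∈ A, C = Ix ∨ C = Iy ∨ IsUnitTriangle C) ∧
      (∀ C ∈ B, C = Ix ∨ C = Iy ∨ IsUnitTriangle C) ∧
      convexHull ℝ (toR '' (P : Set (ℤ × ℤ))) + B.sum = ({toR t} : Set (ℝ × ℝ)) + A.sum := by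
  have hne : P.Nonempty := Finset.card_pos.1 (by omega)
  obtain ⟨t, A, B, a, b, hA, hB, ha, hb, h⟩ := exists_decomposition (hullSupport_mem hne)
  refine ⟨t, A, B, hA, hB, ((hasSupport_hullSupport hne).add hb).eq ?_⟩
  rw [h]
  exact (hasSupport_singleton t).add ha
end

section
/- Let P ⊆ ℤ² be a finite nonempty set. Then there exist integers a₀, b₀, k_x, k_y, a finite set S of unit triangles, and integers k_T for each T ∈ S, such that for all (x,y) ∈ ℝ²: max⟨P⟩(x,y) = a₀·x + b₀·y + k_x·max(0,x) + k_y·max(0,y) + Σ_{T ∈ S} k_T · max⟨V(T)⟩(x,y), where V(T) denotes the three vertices of the triangle T. (The integers k_x, k_y, k_T may be negative.) -/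
/-- The max-plus function `max⟨P⟩ (x,y) = max_{(a,b) ∈ P} (a·x + b·y)` associated with a
set of points `P ⊆ ℝ²`. -/
noncomputable def maxF (P : Set (ℝ × ℝ)) (x y : ℝ) : ℝ :=
  sSup ((fun a : ℝ × ℝ => a.1 * x + a.2 * y) '' P)

namespace MaxPlus

open Finset

/-- The linear form `(x, y) ↦ a x + b y` attached to the lattice point `(a, b)`. -/
noncomputable def linForm (p : ℤ × ℤ) (z : ℝ × ℝ) : ℝ := p.1 * z.1 + p.2 * z.2

/-- The support function of a finite set of lattice points. -/
noncomputable def latticeMax (P : Finset (ℤ × ℤ)) (z : ℝ × ℝ) : ℝ :=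
  maxF (toR '' (P : Set (ℤ × ℤ))) z.1 z.2

/-- The group of functions generated by linear forms, `max 0 x`, `max 0 y` and the max-plus
functions of unit triangles. -/
noncomputable def unitSpan : Submodule ℤ (ℝ × ℝ → ℝ) :=
  Submodule.span ℤ {fun z => z.1, fun z => z.2, fun z => max 0 z.1, fun z => max 0 z.2} ⊔
    Submodule.span ℤ ((fun T z => maxF (Set.extremePoints ℝ T) z.1 z.2) '' {T | IsUnitTriangle T})

/-- The max-plus function of the segment from `0` to `u`. -/
noncomputable def segMax (u : ℤ × ℤ) (z : ℝ × ℝ) : ℝ := max 0 (linForm u z)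

/-- The max-plus function of the triangle with vertices `0`, `u`, `v`. -/
noncomputable def triMax (u v : ℤ × ℤ) (z : ℝ × ℝ) : ℝ :=
  max 0 (max (linForm u z) (linForm v z))

/-- The determinant of two lattice vectors. -/
def det (u v : ℤ × ℤ) : ℤ := u.1 * v.2 - u.2 * v.1

theorem linForm_add (u v : ℤ × ℤ) (z : ℝ × ℝ) :
    linForm (u + v) z = linForm u z + linForm v z := by
  simp only [linForm, Prod.fst_add, Prod.snd_add]; push_cast; ring

theorem linForm_sub (u v : ℤ × ℤ) (z : ℝ × ℝ) :
    linForm (u - v) z = linForm u z - linForm v z := by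
  simp only [linForm, Prod.fst_sub, Prod.snd_sub]; push_cast; ring

theorem linForm_neg (u : ℤ × ℤ) (z : ℝ × ℝ) : linForm (-u) z = -linForm u z := by
  simp only [linForm, Prod.fst_neg, Prod.snd_neg]; push_cast; ring

theorem linForm_smul (n : ℤ) (u : ℤ × ℤ) (z : ℝ × ℝ) :
    linForm (n • u) z = n * linForm u z := by
  simp only [linForm, Prod.smul_fst, Prod.smul_snd, smul_eq_mul]; push_cast; ring

theorem latticeMax_singleton (p : ℤ × ℤ) : latticeMax {p} = linForm p := by
  funext z
  simp [latticeMax, maxF, toR, linForm]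

theorem latticeMax_insert (p : ℤ × ℤ) {P : Finset (ℤ × ℤ)} (hP : P.Nonempty) (z : ℝ × ℝ) :
    latticeMax (insert p P) z = max (linForm p z) (latticeMax P z) := by
  rw [latticeMax, latticeMax, maxF, maxF, coe_insert, Set.image_insert_eq, Set.image_insert_eq,
    csSup_insert]
  · rfl
  · exact ((P.finite_toSet.image _).image _).bddAbove
  · exact ((coe_nonempty.2 hP).image _).image _

theorem linForm_le_latticeMax {p : ℤ × ℤ} {P : Finset (ℤ × ℤ)} (hp : p ∈ P) (z : ℝ × ℝ) :
    linForm p z ≤ latticeMax P z :=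
  le_csSup ((P.finite_toSet.image _).image _).bddAbove ⟨toR p, ⟨p, hp, rfl⟩, rfl⟩

/-- Passing to the extreme points of the convex hull does not change a support function. -/
theorem maxF_extremePoints_convexHull {A : Set (ℝ × ℝ)} (hA : A.Finite) (hne : A.Nonempty)
    (x y : ℝ) : maxF (Set.extremePoints ℝ (convexHull ℝ A)) x y = maxF A x y := by
  have hcomp : IsCompact (convexHull ℝ A) := hA.isCompact_convexHull ℝ
  have hsub : Set.extremePoints ℝ (convexHull ℝ A) ⊆ A := extremePoints_convexHull_subset
  have hEne : (Set.extremePoints ℝ (convexHull ℝ A)).Nonempty :=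
    hcomp.extremePoints_nonempty hne.convexHull
  have hbdd : BddAbove ((fun a : ℝ × ℝ => a.1 * x + a.2 * y) '' A) := (hA.image _).bddAbove
  refine le_antisymm (csSup_le_csSup hbdd (hEne.image _) (Set.image_mono hsub)) ?_
  refine csSup_le (hne.image _) ?_
  rintro _ ⟨a, ha, rfl⟩
  set M := maxF (Set.extremePoints ℝ (convexHull ℝ A)) x y with hM
  have hcont : Continuous fun a : ℝ × ℝ => a.1 * x + a.2 * y := by fun_prop
  have hclosed : IsClosed {a : ℝ × ℝ | a.1 * x + a.2 * y ≤ M} :=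
    isClosed_le hcont continuous_const
  have hconv : Convex ℝ {a : ℝ × ℝ | a.1 * x + a.2 * y ≤ M} := by
    refine convex_halfSpace_le (f := fun a : ℝ × ℝ => a.1 * x + a.2 * y) ⟨?_, ?_⟩ M
    · intro a b
      simp only [Prod.fst_add, Prod.snd_add]; ring
    · intro c a
      simp only [Prod.smul_fst, Prod.smul_snd, smul_eq_mul]; ring
  have hEle : Set.extremePoints ℝ (convexHull ℝ A) ⊆ {a : ℝ × ℝ | a.1 * x + a.2 * y ≤ M} :=
    fun e he => le_csSup (hbdd.mono (Set.image_mono hsub)) ⟨e, he, rfl⟩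
  have hmem : a ∈ closure (convexHull ℝ (Set.extremePoints ℝ (convexHull ℝ A))) := by
    rw [closure_convexHull_extremePoints hcomp (convex_convexHull ℝ A)]
    exact subset_convexHull ℝ A ha
  exact closure_minimal (convexHull_min hEle hconv) hclosed hmem

theorem linForm_mem (p : ℤ × ℤ) : linForm p ∈ unitSpan := by
  have h : linForm p = p.1 • (fun z : ℝ × ℝ => z.1) + p.2 • (fun z : ℝ × ℝ => z.2) := by
    funext z
    simp [linForm]
  rw [h]
  refine add_mem (Submodule.smul_mem _ _ ?_) (Submodule.smul_mem _ _ ?_) <;>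
    exact Submodule.mem_sup_left (Submodule.subset_span (by simp))

theorem triMax_mem_of_abs_det_eq_one {u v : ℤ × ℤ} (h : |det u v| = 1) :
    triMax u v ∈ unitSpan := by
  set m : ℤ × ℤ := (min 0 (min u.1 v.1), min 0 (min u.2 v.2)) with hm
  have hunit : IsUnitTriangle
      (convexHull ℝ ({toR (-m), toR (u - m), toR (v - m)} : Set (ℝ × ℝ))) := by
    refine ⟨-m, u - m, v - m, rfl, ?_, ?_⟩
    · rw [← h]
      simp only [det, Prod.fst_neg, Prod.snd_neg, Prod.fst_sub, Prod.snd_sub]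
      ring_nf
    · simp only [hm, Prod.fst_neg, Prod.snd_neg, Prod.fst_sub, Prod.snd_sub]
      omega
  have heq : triMax u v = (fun z : ℝ × ℝ => maxF (Set.extremePoints ℝ
      (convexHull ℝ ({toR (-m), toR (u - m), toR (v - m)} : Set (ℝ × ℝ)))) z.1 z.2)
      + linForm m := by
    funext z
    have h3 : maxF ({toR (-m), toR (u - m), toR (v - m)} : Set (ℝ × ℝ)) z.1 z.2
        = latticeMax {-m, u - m, v - m} z := by
      simp [latticeMax, Set.image_insert_eq]
    rw [Pi.add_apply, maxF_extremePoints_convexHull (by simp) (by simp), h3,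
      latticeMax_insert _ (by simp), latticeMax_insert _ (by simp), latticeMax_singleton,
      linForm_sub, linForm_sub, linForm_neg, triMax, max_add, max_add]
    congr 1
    · ring
    · congr 1 <;> ring
  rw [heq]
  exact add_mem (Submodule.mem_sup_right (Submodule.subset_span ⟨_, hunit, rfl⟩)) (linForm_mem m)

theorem segMax_neg_mem {u : ℤ × ℤ} (h : segMax u ∈ unitSpan) : segMax (-u) ∈ unitSpan := by
  have heq : segMax (-u) = segMax u - linForm u := by
    funext z
    simp only [segMax, Pi.sub_apply, linForm_neg]
    grind
  rw [heq]
  exact sub_mem h (linForm_mem u)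

/-- The parallelogram relation: a unimodular triangle together with its reflection. -/
theorem segMax_add_mem {u v : ℤ × ℤ} (hu : segMax u ∈ unitSpan) (hv : segMax v ∈ unitSpan)
    (h : |det u v| = 1) : segMax (u + v) ∈ unitSpan := by
  have h1 : |det (-u) v| = 1 := by
    rw [← h, ← abs_neg]; simp only [det, Prod.fst_neg, Prod.snd_neg]; ring_nf
  have h2 : |det u (-v)| = 1 := by
    rw [← h, ← abs_neg]; simp only [det, Prod.fst_neg, Prod.snd_neg]; ring_nf
  have heq : segMax (u + v) =
      triMax (-u) v + linForm v + triMax u (-v) - segMax (-u) - segMax v := by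
    funext z
    simp only [segMax, triMax, Pi.sub_apply, Pi.add_apply, linForm_neg, linForm_add]
    grind
  rw [heq]
  exact sub_mem (sub_mem (add_mem (add_mem (triMax_mem_of_abs_det_eq_one h1) (linForm_mem v))
    (triMax_mem_of_abs_det_eq_one h2)) (segMax_neg_mem hu)) hv

/-- Euclid's algorithm on nonnegative unimodular bases. -/
theorem prop_of_unimodular_basis {M : ℤ → ℤ → Prop} (h10 : M 1 0) (h01 : M 0 1)
    (hadd : ∀ a b c d, M a b → M c d → a * d - b * c = 1 → M (a + c) (b + d)) :
    ∀ (n : ℕ) (a b c d : ℤ), 0 ≤ a → 0 ≤ b → 0 ≤ c → 0 ≤ d → a * d - b * c = 1 →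
      a + b + c + d ≤ n → M a b ∧ M c d := by
  intro n
  induction n with
  | zero =>
    intro a b c d ha hb hc hd h hn
    have : a = 0 := by omega
    have : b = 0 := by omega
    subst_vars
    simp at h
  | succ n ih =>
    intro a b c d ha hb hc hd h hn
    have hab : 0 < a + b := by
      by_contra hcon
      have h1 : a = 0 := by omega
      have h2 : b = 0 := by omega
      simp [h1, h2] at h
    have hcd : 0 < c + d := by
      by_contra hcon
      have h1 : c = 0 := by omega
      have h2 : d = 0 := by omega
      simp [h1, h2] at h
    push_cast at hn
    by_cases h1 : c ≤ a ∧ d ≤ b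
    · obtain ⟨hl, hr⟩ := ih (a - c) (b - d) c d (by omega) (by omega) hc hd (by linarith)
        (by omega)
      refine ⟨?_, hr⟩
      simpa using hadd _ _ _ _ hl hr (by linarith)
    by_cases h2 : a ≤ c ∧ b ≤ d
    · obtain ⟨hl, hr⟩ := ih a b (c - a) (d - b) ha hb (by omega) (by omega) (by linarith)
        (by omega)
      refine ⟨hl, ?_⟩
      simpa using hadd _ _ _ _ hl hr (by linarith)
    by_cases h3 : c < a
    · have h4 : b + 1 ≤ d := by omega
      have h5 : b = 0 := by nlinarith
      have h6 : c = 0 := by nlinarith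
      subst h5 h6
      have h7 : a = 1 := by nlinarith
      have h8 : d = 1 := by nlinarith
      subst h7 h8
      exact ⟨h10, h01⟩
    · have h4 : d ≤ b := by omega
      exfalso
      nlinarith

/-- A property of lattice vectors holding on the standard basis and stable under sums of
unimodular pairs holds for all nonnegative primitive vectors. -/
theorem prop_of_coprime {M : ℤ → ℤ → Prop} (h10 : M 1 0) (h01 : M 0 1)
    (hadd : ∀ a b c d, M a b → M c d → a * d - b * c = 1 → M (a + c) (b + d))
    {a b : ℤ} (ha : 0 ≤ a) (hb : 0 ≤ b) (h : IsCoprime a b) : M a b := by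
  rcases ha.eq_or_lt with rfl | ha
  · rw [isCoprime_zero_left, Int.isUnit_iff] at h
    obtain rfl : b = 1 := by omega
    exact h01
  rcases hb.eq_or_lt with rfl | hb
  · rw [isCoprime_zero_right, Int.isUnit_iff] at h
    obtain rfl : a = 1 := by omega
    exact h10
  obtain ⟨s, t, hst⟩ := h
  have hs : 0 ≤ s + (|s| + |t|) * b := by nlinarith [abs_nonneg t, neg_abs_le s, abs_nonneg s]
  have ht : 0 ≤ -t + (|s| + |t|) * a := by nlinarith [abs_nonneg t, le_abs_self t, abs_nonneg s]
  exact (prop_of_unimodular_basis h10 h01 hadd _ a b _ _ ha.le hb.le ht hs (by linarith)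
    (Int.self_le_toNat _)).1

theorem segMax_mem_of_isCoprime {a b : ℤ} (h : IsCoprime a b) : segMax (a, b) ∈ unitSpan := by
  have h10 : segMax (1, 0) ∈ unitSpan :=
    Submodule.mem_sup_left (Submodule.subset_span (by
      simp [show segMax (1, 0) = fun z => max 0 z.1 by funext z; simp [segMax, linForm]]))
  have h01 : segMax (0, 1) ∈ unitSpan :=
    Submodule.mem_sup_left (Submodule.subset_span (by
      simp [show segMax (0, 1) = fun z => max 0 z.2 by funext z; simp [segMax, linForm]]))
  have hpos : ∀ a b : ℤ, 0 ≤ a → 0 ≤ b → IsCoprime a b → segMax (a, b) ∈ unitSpan := by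
    intro a b ha hb h
    refine prop_of_coprime (M := fun a b => segMax (a, b) ∈ unitSpan) h10 h01 ?_ ha hb h
    intro a b c d hab hcd hdet
    exact segMax_add_mem hab hcd (by simp [det, hdet])
  have hneg : ∀ a b : ℤ, 0 ≤ a → 0 ≤ b → IsCoprime a b → segMax (a, -b) ∈ unitSpan := by
    intro a b ha hb h
    refine prop_of_coprime (M := fun a b => segMax (a, -b) ∈ unitSpan) (by simpa using h10)
      (by simpa using segMax_neg_mem h01) ?_ ha hb h
    intro a b c d hab hcd hdet
    have hdet' : |det (a, -b) (c, -d)| = 1 := by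
      rw [← abs_neg, det, show -(a * -d - -b * c) = a * d - b * c by ring, hdet, abs_one]
    have hsum := segMax_add_mem hab hcd hdet'
    rwa [Prod.mk_add_mk, ← neg_add] at hsum
  rcases le_total 0 a with ha | ha <;> rcases le_total 0 b with hb | hb
  · exact hpos a b ha hb h
  · simpa using hneg a (-b) ha (by omega) h.neg_right
  · simpa using segMax_neg_mem (hneg (-a) b (by omega) hb h.neg_left)
  · simpa using segMax_neg_mem (hpos (-a) (-b) (by omega) (by omega) h.neg_left.neg_right)

theorem exists_primitive {u : ℤ × ℤ} (hu : u ≠ 0) :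
    ∃ (g : ℤ) (u' w : ℤ × ℤ), 0 < g ∧ u = g • u' ∧ det u' w = 1 := by
  obtain ⟨a, b⟩ := u
  have hg : 0 < Int.gcd a b := by
    rw [Int.gcd_pos_iff]
    by_contra hcon
    push Not at hcon
    exact hu (by simp [hcon.1, hcon.2])
  obtain ⟨a', ha⟩ := Int.gcd_dvd_left a b
  obtain ⟨b', hb⟩ := Int.gcd_dvd_right a b
  refine ⟨Int.gcd a b, (a', b'), (-Int.gcdB a b, Int.gcdA a b), by exact_mod_cast hg, ?_, ?_⟩
  · ext
    · exact ha
    · exact hb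
  · have hbez := Int.gcd_eq_gcd_ab a b
    have hg' : (Int.gcd a b : ℤ) ≠ 0 := by exact_mod_cast hg.ne'
    refine mul_left_cancel₀ hg' ?_
    simp only [det]
    linear_combination (-Int.gcdA a b) * ha - Int.gcdB a b * hb - hbez

theorem segMax_mem (u : ℤ × ℤ) : segMax u ∈ unitSpan := by
  by_cases hu : u = 0
  · have heq : segMax u = 0 := by
      funext z
      simp [hu, segMax, linForm]
    rw [heq]
    exact zero_mem _
  obtain ⟨g, u', w, hg, rfl, hw⟩ := exists_primitive hu
  have heq : segMax (g • u') = g • segMax u' := by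
    funext z
    have hg' : (0 : ℝ) ≤ g := by exact_mod_cast hg.le
    rw [Pi.smul_apply, segMax, segMax, linForm_smul, zsmul_eq_mul, mul_max_of_nonneg _ _ hg',
      mul_zero]
  rw [heq]
  exact Submodule.smul_mem _ _ (segMax_mem_of_isCoprime
    ⟨w.2, -w.1, by rw [det] at hw; linarith⟩)

theorem triMax_comm (u v : ℤ × ℤ) : triMax u v = triMax v u := by
  funext z
  rw [triMax, triMax, max_comm (linForm u z)]

theorem triMax_mem_of_det_eq_zero {u v : ℤ × ℤ} (h : det u v = 0) : triMax u v ∈ unitSpan := by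
  by_cases hu : u = 0
  · have heq : triMax u v = segMax v := by
      funext z
      simp [triMax, segMax, hu, linForm]
    rw [heq]
    exact segMax_mem v
  obtain ⟨g, u', w, hg, rfl, hw⟩ := exists_primitive hu
  have hg' : (0 : ℝ) < g := by exact_mod_cast hg
  have h0 : det u' v = 0 := by
    refine (mul_eq_zero_iff_left hg.ne').1 ?_
    rw [← h]
    simp only [det, Prod.smul_fst, Prod.smul_snd, smul_eq_mul]
    ring
  obtain ⟨m, rfl⟩ : ∃ m : ℤ, v = m • u' := by
    refine ⟨det v w, ?_⟩
    simp only [det] at *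
    ext <;> simp only [Prod.smul_fst, Prod.smul_snd, smul_eq_mul]
    · linear_combination (-v.1) * hw + w.1 * h0
    · linear_combination (-v.2) * hw + w.2 * h0
  rcases le_total m 0 with hm | hm
  · have heq : triMax (g • u') (m • u') = linForm (m • u') + segMax ((g - m) • u') := by
      funext z
      have hm' : (m : ℝ) ≤ 0 := by exact_mod_cast hm
      simp only [triMax, segMax, Pi.add_apply, linForm_smul]
      push_cast
      rcases le_total 0 (linForm u' z) with hz | hz
      · rw [max_eq_left (a := g * linForm u' z) (by nlinarith), max_eq_right (by positivity),
          max_eq_right (by nlinarith)]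
        ring
      · rw [max_eq_right (a := g * linForm u' z) (by nlinarith), max_eq_right (by nlinarith),
          max_eq_left (by nlinarith)]
        ring
    rw [heq]
    exact add_mem (linForm_mem _) (segMax_mem _)
  · have heq : triMax (g • u') (m • u') = segMax ((max g m) • u') := by
      funext z
      have hm' : (0 : ℝ) ≤ m := by exact_mod_cast hm
      simp only [triMax, segMax, linForm_smul]
      push_cast
      rcases le_total 0 (linForm u' z) with hz | hz
      · rw [max_mul_of_nonneg _ _ hz]
      · have h1 : g * linForm u' z ≤ 0 := by nlinarith
        have h2 : m * linForm u' z ≤ 0 := by nlinarith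
        rw [max_eq_left (max_le h1 h2), max_eq_left]
        exact mul_nonpos_of_nonneg_of_nonpos (le_max_of_le_left hg'.le) hz
    rw [heq]
    exact segMax_mem _

/-- Splitting a triangle at an intermediate point `n`. -/
theorem triMax_split {u v n : ℤ × ℤ}
    (h : ∀ z, min 0 (min (linForm u z) (linForm v z)) ≤ linForm n z ∧
      linForm n z ≤ triMax u v z)
    (h1 : triMax u n ∈ unitSpan) (h2 : triMax n v ∈ unitSpan)
    (h3 : triMax (u - n) (v - n) ∈ unitSpan) : triMax u v ∈ unitSpan := by
  have heq : triMax u v = triMax u n + triMax n v + (linForm n + triMax (u - n) (v - n))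
      - segMax n - (linForm n + segMax (u - n)) - (linForm n + segMax (v - n)) + linForm n := by
    funext z
    have hz := h z
    simp only [triMax, segMax, Pi.add_apply, Pi.sub_apply, linForm_sub] at *
    grind
  rw [heq]
  exact add_mem (sub_mem (sub_mem (sub_mem (add_mem (add_mem h1 h2)
    (add_mem (linForm_mem n) h3)) (segMax_mem n)) (add_mem (linForm_mem n) (segMax_mem _)))
    (add_mem (linForm_mem n) (segMax_mem _))) (linForm_mem n)

/-- If `D • n` is a nonnegative combination of `0`, `u`, `v` of total weight `D`, then `n` lies in
the triangle they span. -/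
theorem linForm_between {u v n : ℤ × ℤ} {D r s : ℤ} (hD : 0 < D) (hr : 0 ≤ r) (hs : 0 ≤ s)
    (hrs : r + s ≤ D) (hn : D • n = r • u + s • v) (z : ℝ × ℝ) :
    min 0 (min (linForm u z) (linForm v z)) ≤ linForm n z ∧ linForm n z ≤ triMax u v z := by
  have h : (D : ℝ) * linForm n z = r * linForm u z + s * linForm v z := by
    rw [← linForm_smul, hn, linForm_add, linForm_smul, linForm_smul]
  have hD' : (0 : ℝ) < D := by exact_mod_cast hD
  have hr' : (0 : ℝ) ≤ r := by exact_mod_cast hr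
  have hs' : (0 : ℝ) ≤ s := by exact_mod_cast hs
  have hrs' : (r : ℝ) + s ≤ D := by exact_mod_cast hrs
  constructor
  · refine le_of_mul_le_mul_left ?_ hD'
    set m := min 0 (min (linForm u z) (linForm v z))
    have h0 : m ≤ 0 := min_le_left _ _
    have hu : m ≤ linForm u z := (min_le_right _ _).trans (min_le_left _ _)
    have hv : m ≤ linForm v z := (min_le_right _ _).trans (min_le_right _ _)
    nlinarith [mul_le_mul_of_nonneg_left hu hr', mul_le_mul_of_nonneg_left hv hs']
  · refine le_of_mul_le_mul_left ?_ hD'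
    have h0 : 0 ≤ triMax u v z := le_max_left _ _
    have hu : linForm u z ≤ triMax u v z := (le_max_left _ _).trans (le_max_right _ _)
    have hv : linForm v z ≤ triMax u v z := (le_max_right _ _).trans (le_max_right _ _)
    nlinarith [mul_le_mul_of_nonneg_left hu hr', mul_le_mul_of_nonneg_left hv hs']

/-- A lattice triangle of determinant `D ≥ 2` contains a lattice point splitting it into triangles
of smaller determinant. -/
theorem exists_splitting_point {u v : ℤ × ℤ} (h : 2 ≤ det u v) :
    ∃ (n : ℤ × ℤ) (D r s : ℤ), 0 < D ∧ 0 ≤ r ∧ 0 ≤ s ∧ r + s ≤ D ∧ D • n = r • u + s • v ∧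
      |det u n| < det u v ∧ |det n v| < det u v ∧ |det (u - n) (v - n)| < det u v := by
  have hu : u ≠ 0 := by
    rintro rfl
    simp [det] at h
  obtain ⟨g, u', w, hg, rfl, hw⟩ := exists_primitive hu
  have hdet : det (g • u') v = g * det u' v := by
    simp only [det, Prod.smul_fst, Prod.smul_snd, smul_eq_mul]; ring
  have hd : 0 < det u' v := by
    by_contra hcon
    nlinarith
  rcases (show 1 ≤ g from hg).eq_or_lt with rfl | hg2
  · rw [one_smul] at *
    set d := det u' v with hdd
    set c := det v w with hc
    have hv1 : v.1 = c * u'.1 + d * w.1 := by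
      simp only [det] at *; rw [hc, hdd]; linear_combination (-v.1) * hw
    have hv2 : v.2 = c * u'.2 + d * w.2 := by
      simp only [det] at *; rw [hc, hdd]; linear_combination (-v.2) * hw
    set r := (-c) % d with hr
    set e := -((-c) / d) with he
    have hre : d * e = c + r := by
      have := Int.mul_ediv_add_emod (-c) d
      rw [he]; linarith
    have hr0 : 0 ≤ r := Int.emod_nonneg _ hd.ne'
    have hrd : r < d := Int.emod_lt_of_pos _ hd
    have e1 : det u' (w + e • u') = 1 := by
      rw [← hw]
      simp only [det, Prod.fst_add, Prod.snd_add, Prod.smul_fst, Prod.smul_snd, smul_eq_mul]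
      ring
    have e2 : det (w + e • u') v = r := by
      simp only [det, Prod.fst_add, Prod.snd_add, Prod.smul_fst, Prod.smul_snd, smul_eq_mul]
        at hw ⊢
      rw [hv1, hv2]
      linear_combination hre + (e * d - c) * hw
    have e3 : det (u' - (w + e • u')) (v - (w + e • u')) = d - 1 - r := by
      have : det (u' - (w + e • u')) (v - (w + e • u'))
          = det u' v - det u' (w + e • u') - det (w + e • u') v := by
        simp only [det, Prod.fst_sub, Prod.snd_sub]
        ring
      rw [this, e1, e2]
    refine ⟨w + e • u', d, r, 1, hd, hr0, by omega, by omega, ?_, ?_, ?_, ?_⟩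
    · ext <;> simp only [Prod.fst_add, Prod.snd_add, Prod.smul_fst, Prod.smul_snd, smul_eq_mul]
      · rw [hv1]; linear_combination u'.1 * hre
      · rw [hv2]; linear_combination u'.2 * hre
    · rw [e1, abs_one]; omega
    · rw [e2, abs_of_nonneg hr0]; exact hrd
    · rw [e3, abs_of_nonneg (by omega)]; omega
  · have e1 : det (g • u') u' = 0 := by
      simp only [det, Prod.smul_fst, Prod.smul_snd, smul_eq_mul]; ring
    have e3 : det (g • u' - u') (v - u') = (g - 1) * det u' v := by
      simp only [det, Prod.smul_fst, Prod.smul_snd, Prod.fst_sub, Prod.snd_sub, smul_eq_mul]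
      ring
    refine ⟨u', g, 1, 0, hg, by omega, le_rfl, by omega, by simp, ?_, ?_, ?_⟩
    · rw [e1, abs_zero]; omega
    · rw [hdet, abs_of_pos hd]; nlinarith
    · rw [e3, hdet, abs_of_nonneg (mul_nonneg (by omega) hd.le)]; nlinarith

theorem triMax_mem (u v : ℤ × ℤ) : triMax u v ∈ unitSpan := by
  suffices H : ∀ (N : ℕ) (u v : ℤ × ℤ), |det u v| ≤ N → triMax u v ∈ unitSpan from
    H _ u v (Int.self_le_toNat _)
  intro N
  induction N with
  | zero =>
    intro u v h
    exact triMax_mem_of_det_eq_zero (abs_nonpos_iff.1 (by exact_mod_cast h))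
  | succ N ih =>
    have hpos : ∀ u v : ℤ × ℤ, 0 ≤ det u v → |det u v| ≤ (N + 1 : ℕ) →
        triMax u v ∈ unitSpan := by
      intro u v h0 h
      push_cast at h
      rw [abs_of_nonneg h0] at h
      rcases (show det u v = 0 ∨ det u v = 1 ∨ 2 ≤ det u v by omega) with h' | h' | h'
      · exact triMax_mem_of_det_eq_zero h'
      · exact triMax_mem_of_abs_det_eq_one (by rw [h', abs_one])
      obtain ⟨n, D, r, s, hD, hr, hs, hrs, hn, h1, h2, h3⟩ := exists_splitting_point h'
      exact triMax_split (linForm_between hD hr hs hrs hn) (ih _ _ (by omega))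
        (ih _ _ (by omega)) (ih _ _ (by omega))
    intro u v h
    rcases le_total 0 (det u v) with h0 | h0
    · exact hpos u v h0 h
    · have hswap : det v u = -det u v := by
        simp only [det]; ring
      rw [triMax_comm]
      exact hpos v u (by omega) (by rwa [hswap, abs_neg])

theorem toR_injective : Function.Injective toR := by
  intro p q h
  simp only [toR, Prod.mk.injEq, Int.cast_inj] at h
  exact Prod.ext h.1 h.2

/-- Radon's theorem for four lattice points: one or two of them have a convex combination in
the convex hull of the others; stated in terms of linear forms. -/
theorem exists_radon_subset {P : Finset (ℤ × ℤ)} (hP : 4 ≤ P.card) :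
    ∃ A ⊆ P, A.Nonempty ∧ A.card ≤ 2 ∧ (P \ A).Nonempty ∧
      ∀ z, ∃ p ∈ A, linForm p z ≤ latticeMax (P \ A) z := by
  obtain ⟨Q, hQP, hQ⟩ := exists_subset_card_eq hP
  obtain ⟨f, hf1, hf2, hf3⟩ : ∃ f : ℤ × ℤ → ℝ, (∀ z, ∑ p ∈ Q, f p * linForm p z = 0) ∧
      ∑ p ∈ Q, f p = 0 ∧ ∃ p ∈ Q, f p ≠ 0 := by
    have hcard : Module.finrank ℝ (ℝ × ℝ) + 1 < (Q.map ⟨toR, toR_injective⟩).card := by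
      simp [hQ]
    obtain ⟨f, h1, h2, h3⟩ :=
      Module.exists_nontrivial_relation_sum_zero_of_finrank_succ_lt_card hcard
    simp only [sum_map, Function.Embedding.coeFn_mk, mem_map, exists_exists_and_eq_and] at h1 h2 h3
    refine ⟨fun p => f (toR p), fun z => ?_, h2, h3⟩
    have h11 := congrArg Prod.fst h1
    have h12 := congrArg Prod.snd h1
    simp only [Prod.fst_sum, Prod.snd_sum, Prod.smul_fst, Prod.smul_snd, smul_eq_mul, toR,
      Prod.fst_zero, Prod.snd_zero] at h11 h12
    calc ∑ p ∈ Q, f (toR p) * linForm p z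
        = (∑ p ∈ Q, f (toR p) * p.1) * z.1 + (∑ p ∈ Q, f (toR p) * p.2) * z.2 := by
          rw [sum_mul, sum_mul, ← sum_add_distrib]
          exact sum_congr rfl fun p _ => by rw [linForm]; ring
      _ = 0 := by simp only [toR]; rw [h11, h12]; ring
  have key : ∀ f : ℤ × ℤ → ℝ, (∀ z, ∑ p ∈ Q, f p * linForm p z = 0) → ∑ p ∈ Q, f p = 0 →
      (∃ p ∈ Q, f p ≠ 0) → (Q.filter (0 < f ·)).card ≤ 2 →
      ∃ A ⊆ P, A.Nonempty ∧ A.card ≤ 2 ∧ (P \ A).Nonempty ∧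
        ∀ z, ∃ p ∈ A, linForm p z ≤ latticeMax (P \ A) z := by
    intro f hf1 hf2 hf3 hcard
    obtain ⟨p₀, hp₀, hp₀'⟩ := exists_pos_of_sum_zero_of_exists_nonzero f hf2 hf3
    refine ⟨Q.filter (0 < f ·), (filter_subset _ _).trans hQP, ⟨p₀, by simp [hp₀, hp₀']⟩, hcard,
      ?_, ?_⟩
    · rw [← card_pos, card_sdiff_of_subset ((filter_subset _ _).trans hQP)]
      omega
    · intro z
      by_contra! hcon
      set M := latticeMax (P \ Q.filter (0 < f ·)) z
      have hlt : ∑ p ∈ Q, f p * M < ∑ p ∈ Q, f p * linForm p z := by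
        refine sum_lt_sum (fun p hp => ?_) ⟨p₀, hp₀, ?_⟩
        · by_cases hfp : 0 < f p
          · exact mul_le_mul_of_nonneg_left (hcon p (by simp [hp, hfp])).le hfp.le
          · refine mul_le_mul_of_nonpos_left (linForm_le_latticeMax ?_ z) (not_lt.1 hfp)
            simp [hQP hp, hfp]
        · exact mul_lt_mul_of_pos_left (hcon p₀ (by simp [hp₀, hp₀'])) hp₀'
      rw [← sum_mul, hf2, hf1 z, zero_mul] at hlt
      exact lt_irrefl _ hlt
  by_cases hcard : (Q.filter (0 < f ·)).card ≤ 2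
  · exact key f hf1 hf2 hf3 hcard
  · refine key (fun p => -f p) (fun z => ?_) ?_ ?_ ?_
    · simp [hf1 z]
    · simp [hf2]
    · simpa using hf3
    · have hdisj : Disjoint (Q.filter (0 < f ·)) (Q.filter (0 < -f ·)) :=
        disjoint_filter.2 fun p _ h1 h2 => by linarith
      have := card_le_card (union_subset (filter_subset (0 < f ·) Q) (filter_subset (0 < -f ·) Q))
      rw [card_union_of_disjoint hdisj] at this
      omega

theorem latticeMax_pair (p q : ℤ × ℤ) :
    latticeMax {p, q} = linForm p + segMax (q - p) := by
  funext z
  rw [latticeMax_insert _ (by simp), latticeMax_singleton, Pi.add_apply, segMax, linForm_sub]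
  grind

theorem latticeMax_triple (p q r : ℤ × ℤ) :
    latticeMax {p, q, r} = linForm p + triMax (q - p) (r - p) := by
  funext z
  rw [latticeMax_insert _ (by simp), latticeMax_insert _ (by simp), latticeMax_singleton,
    Pi.add_apply, triMax, linForm_sub, linForm_sub]
  grind

theorem latticeMax_mem (P : Finset (ℤ × ℤ)) (hP : P.Nonempty) : latticeMax P ∈ unitSpan := by
  induction P using Finset.strongInduction with
  | H P ih =>
  by_cases hcard : 4 ≤ P.card
  · obtain ⟨A, hAP, hA, hA2, hR, hle⟩ := exists_radon_subset hcard
    set R := P \ A with hRdef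
    have hPeq : P = A ∪ R := (union_sdiff_of_subset hAP).symm
    have hdisj : Disjoint A R := disjoint_sdiff
    have hRss : R ⊂ P := sdiff_ssubset hAP hA
    rcases (show A.card = 1 ∨ A.card = 2 by have := card_pos.2 hA; omega) with h1 | h2
    · obtain ⟨a, rfl⟩ := card_eq_one.1 h1
      have heq : latticeMax P = latticeMax R := by
        funext z
        obtain ⟨p, hp, hpz⟩ := hle z
        rw [mem_singleton.1 hp] at hpz
        rw [hPeq, ← insert_eq, latticeMax_insert _ hR, max_eq_right hpz]
      rw [heq]
      exact ih R hRss hR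
    · obtain ⟨a, b, hab, rfl⟩ := card_eq_two.1 h2
      have hPeq' : P = insert a (insert b R) := by
        rw [hPeq, insert_union, ← insert_eq]
      have haR : a ∉ R := by simp [hRdef]
      have hbR : b ∉ R := by simp [hRdef]
      have ha : insert a R ⊂ P := by
        refine (ssubset_iff_of_subset ?_).2 ⟨b, ?_, ?_⟩
        · rw [hPeq']; exact insert_subset_insert _ (subset_insert _ _)
        · exact hAP (by simp)
        · simp [hab.symm, hbR]
      have hb : insert b R ⊂ P := by
        rw [hPeq']
        exact ssubset_insert (by simp [hab, haR])
      have heq : latticeMax P =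
          latticeMax (insert a R) + latticeMax (insert b R) - latticeMax R := by
        funext z
        have hz : linForm a z ≤ latticeMax R z ∨ linForm b z ≤ latticeMax R z := by
          simpa using hle z
        rw [Pi.sub_apply, Pi.add_apply, hPeq', latticeMax_insert _ (insert_nonempty _ _),
          latticeMax_insert _ hR, latticeMax_insert _ hR]
        grind
      rw [heq]
      exact sub_mem (add_mem (ih _ ha (insert_nonempty _ _)) (ih _ hb (insert_nonempty _ _)))
        (ih R hRss hR)
  · have hpos := card_pos.2 hP
    rcases (show P.card = 1 ∨ P.card = 2 ∨ P.card = 3 by omega) with h | h | h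
    · obtain ⟨p, rfl⟩ := card_eq_one.1 h
      rw [latticeMax_singleton]
      exact linForm_mem p
    · obtain ⟨p, q, -, rfl⟩ := card_eq_two.1 h
      rw [latticeMax_pair]
      exact add_mem (linForm_mem _) (segMax_mem _)
    · obtain ⟨p, q, r, -, -, -, rfl⟩ := card_eq_three.1 h
      rw [latticeMax_triple]
      exact add_mem (linForm_mem _) (triMax_mem _ _)

end MaxPlus

/-- Every max-plus function with integer coefficients factors through
linear terms, `max(0,x)`, `max(0,y)`, and max-plus functions of the vertices of finitely
many unit triangles, with (possibly negative) integer coefficients. -/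
theorem maxPlus_factorization (P : Finset (ℤ × ℤ)) (hP : P.Nonempty) :
    ∃ (a₀ b₀ kx ky : ℤ) (S : Finset (Set (ℝ × ℝ))) (k : Set (ℝ × ℝ) → ℤ),
      (∀ T ∈ S, IsUnitTriangle T) ∧
      ∀ x y : ℝ,
        maxF (toR '' (P : Set (ℤ × ℤ))) x y =
          (a₀ : ℝ) * x + (b₀ : ℝ) * y + (kx : ℝ) * max 0 x + (ky : ℝ) * max 0 y +
            ∑ T ∈ S, (k T : ℝ) * maxF (Set.extremePoints ℝ T) x y := by
  obtain ⟨f, hf, g, hg, hfg⟩ := Submodule.mem_sup.1 (MaxPlus.latticeMax_mem P hP)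
  obtain ⟨k, hk, rfl⟩ := (Finsupp.mem_span_image_iff_linearCombination ℤ).1 hg
  simp only [Submodule.mem_span_insert, Submodule.mem_span_singleton] at hf
  obtain ⟨a₀, _, ⟨b₀, _, ⟨kx, _, ⟨ky, rfl⟩, rfl⟩, rfl⟩, rfl⟩ := hf
  refine ⟨a₀, b₀, kx, ky, k.support, k, fun T hT => (Finsupp.mem_supported ℤ k).1 hk hT, ?_⟩
  intro x y
  have h := congrFun hfg (x, y)
  simp only [MaxPlus.latticeMax, Finsupp.linearCombination_apply, Finsupp.sum, Pi.add_apply,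
    Pi.smul_apply, Finset.sum_apply] at h
  simp only [zsmul_eq_mul] at h
  rw [← h]
  ring
end
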